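/- Let V be a Banach 𝕆-bimodule and T a bounded right para-linear operator on V. Fix v ∈ V, J ∈ 𝕊 and a continuous octonionic linear functional φ ∈ V^{*𝕆}, and define g(s) := φ(π_J((R_s − T)^{−⊚}(v))) for s ∈ ρ_{*J}(T). Then g takes values in ℂ_J and is holomorphic on the open subset ρ_{*J}(T) of ℂ_J. -/

import Mathlib

noncomputable section

open scoped BigOperators

/-- Octonions, realized via the Cayley–Dickson doubling of the quaternions. -/
@[ext]
structure Oct : Type where
  a : Quaternion ℝ
  b : Quaternion ℝ

namespace Oct

instance : Zero Oct := ⟨⟨0, 0⟩⟩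
instance : Add Oct := ⟨fun x y => ⟨x.a + y.a, x.b + y.b⟩⟩
instance : Neg Oct := ⟨fun x => ⟨-x.a, -x.b⟩⟩
instance : Sub Oct := ⟨fun x y => ⟨x.a - y.a, x.b - y.b⟩⟩
instance : SMul ℕ Oct := ⟨fun n x => ⟨n • x.a, n • x.b⟩⟩
instance : SMul ℤ Oct := ⟨fun n x => ⟨n • x.a, n • x.b⟩⟩
instance : SMul ℝ Oct := ⟨fun r x => ⟨r • x.a, r • x.b⟩⟩

def toLp (x : Oct) : WithLp 2 (Quaternion ℝ × Quaternion ℝ) :=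
  (WithLp.equiv 2 (Quaternion ℝ × Quaternion ℝ)).symm (x.a, x.b)

lemma toLp_injective : Function.Injective toLp := by
  rintro ⟨xa, xb⟩ ⟨ya, yb⟩ h
  have ha : xa = ya :=
    congrArg (fun z => (WithLp.equiv 2 (Quaternion ℝ × Quaternion ℝ) z).1) h
  have hb : xb = yb :=
    congrArg (fun z => (WithLp.equiv 2 (Quaternion ℝ × Quaternion ℝ) z).2) h
  subst ha; subst hb; rfl

instance : AddCommGroup Oct :=
  toLp_injective.addCommGroup toLp rfl (fun _ _ => rfl) (fun _ => rfl) (fun _ _ => rfl)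
    (fun _ _ => rfl) (fun _ _ => rfl)

def toLpHom : Oct →+ WithLp 2 (Quaternion ℝ × Quaternion ℝ) where
  toFun := toLp
  map_zero' := rfl
  map_add' _ _ := rfl

instance : Module ℝ Oct := toLp_injective.module ℝ toLpHom fun _ _ => rfl

instance : NormedAddCommGroup Oct :=
  NormedAddCommGroup.induced Oct (WithLp 2 (Quaternion ℝ × Quaternion ℝ)) toLpHom toLp_injective

instance : NormedSpace ℝ Oct := ⟨fun r x => norm_smul_le r (toLp x)⟩

def toProdLin : Oct →ₗ[ℝ] Quaternion ℝ × Quaternion ℝ where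
  toFun x := (x.a, x.b)
  map_add' _ _ := rfl
  map_smul' _ _ := rfl

lemma toProdLin_injective : Function.Injective toProdLin := by
  rintro ⟨xa, xb⟩ ⟨ya, yb⟩ h
  have ha : xa = ya := congrArg Prod.fst h
  have hb : xb = yb := congrArg Prod.snd h
  subst ha; subst hb; rfl

instance : FiniteDimensional ℝ Oct :=
  FiniteDimensional.of_injective toProdLin toProdLin_injective

instance : CompleteSpace Oct := FiniteDimensional.complete ℝ Oct

instance : One Oct := ⟨⟨1, 0⟩⟩

instance : Mul Oct :=
  ⟨fun x y => ⟨x.a * y.a - star y.b * x.b, y.b * x.a + x.b * star y.a⟩⟩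

/-- Octonionic conjugation. -/
def conj (x : Oct) : Oct := ⟨star x.a, -x.b⟩

/-- The real part of an octonion. -/
def re (x : Oct) : ℝ := x.a.re

/-- Powers of an octonion (association chosen on the left factor). -/
def opow (s : Oct) : ℕ → Oct
  | 0 => 1
  | n + 1 => s * opow s n

/-- The inverse of a nonzero octonion. -/
def oinv (s : Oct) : Oct := (‖s‖ ^ 2)⁻¹ • conj s

/-- `invPow s n` is the octonion `s ^ (-1 - n)`. -/
def invPow (s : Oct) (n : ℕ) : Oct := opow (oinv s) (n + 1)

def eNat : ℕ → Oct
  | 0 => ⟨1, 0⟩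
  | 1 => ⟨⟨0, 1, 0, 0⟩, 0⟩
  | 2 => ⟨⟨0, 0, 1, 0⟩, 0⟩
  | 3 => ⟨⟨0, 0, 0, 1⟩, 0⟩
  | 4 => ⟨0, 1⟩
  | 5 => ⟨0, ⟨0, 1, 0, 0⟩⟩
  | 6 => ⟨0, ⟨0, 0, 1, 0⟩⟩
  | 7 => ⟨0, ⟨0, 0, 0, 1⟩⟩
  | _ => 0

/-- The standard basis `e_0 = 1, e_1, …, e_7` of the octonions. -/
def e (i : Fin 8) : Oct := eNat i.val

/-- The six-dimensional sphere `𝕊` of imaginary units of `𝕆`. -/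
def unitSphere : Set Oct := {J | J * J = -1}

/-- The slice `ℂ_J = ℝ ⊕ ℝJ` of the octonions. -/
def sliceC (J : Oct) : Set Oct := {s | ∃ x y : ℝ, s = x • (1 : Oct) + y • J}

/-- The embedding of `ℂ` onto the slice `ℂ_J`, `x + y i ↦ x + y J`. -/
def toSlice (J : Oct) (z : ℂ) : Oct := z.re • (1 : Oct) + z.im • J

end Oct

open Oct

/-- A (normed/Banach) `𝕆`-bimodule: a real normed space with continuous real-bilinear left and
right octonionic multiplications satisfying the alternativity relations
`[p,q,x] = [q,x,p] = [x,p,q] = -[q,p,x]` and the norm identities `‖px‖ = |p|‖x‖ = ‖xp‖`. -/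
class OctBimodule (V : Type*) [NormedAddCommGroup V] [NormedSpace ℝ V] : Type _ where
  lm : Oct →ₗ[ℝ] V →L[ℝ] V
  rm : Oct →ₗ[ℝ] V →L[ℝ] V
  lm_one : ∀ x : V, lm 1 x = x
  rm_one : ∀ x : V, rm 1 x = x
  /-- `[p,q,x] = [q,x,p]` -/
  assoc_cyc₁ : ∀ (p q : Oct) (x : V),
    lm (p * q) x - lm p (lm q x) = rm p (lm q x) - lm q (rm p x)
  /-- `[p,q,x] = [x,p,q]` -/
  assoc_cyc₂ : ∀ (p q : Oct) (x : V),
    lm (p * q) x - lm p (lm q x) = rm q (rm p x) - rm (p * q) x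
  /-- `[p,q,x] = -[q,p,x]` -/
  assoc_alt : ∀ (p q : Oct) (x : V),
    lm (p * q) x - lm p (lm q x) = -(lm (q * p) x - lm q (lm p x))
  norm_lm : ∀ (p : Oct) (x : V), ‖lm p x‖ = ‖p‖ * ‖x‖
  norm_rm : ∀ (p : Oct) (x : V), ‖rm p x‖ = ‖p‖ * ‖x‖

section OctMod

variable {V : Type*} [NormedAddCommGroup V] [NormedSpace ℝ V] [OctBimodule V]

/-- Left multiplication `x ↦ p x` as a bounded real-linear operator. -/
def lmo (p : Oct) : V →L[ℝ] V := OctBimodule.lm p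

/-- Right multiplication `R_p : x ↦ x p` as a bounded real-linear operator. -/
def rmo (p : Oct) : V →L[ℝ] V := OctBimodule.rm p

variable (V)

/-- The real-part projection `Re x = (5/12) x - (1/12) ∑_{i=1}^7 e_i x e_i` of an
`𝕆`-bimodule. -/
def reO : V →L[ℝ] V :=
  (5 / 12 : ℝ) • ContinuousLinearMap.id ℝ V -
    (1 / 12 : ℝ) • ∑ i : Fin 7, (rmo (e i.succ)).comp (lmo (e i.succ))

/-- The real part `Re V` of an `𝕆`-bimodule, i.e. the set of associative central elements. -/
def ReSet : Set V :=
  {m | (∀ p q : Oct, lmo (p * q) m = lmo p (lmo q m)) ∧ ∀ p : Oct, lmo p m = rmo p m}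

/-- The slice `ℂ_J(V) = Re V ⊕ J · Re V` of an `𝕆`-bimodule. -/
def CJV (J : Oct) : Set V :=
  {x | ∃ u ∈ ReSet V, ∃ w ∈ ReSet V, x = u + lmo J w}

/-- The slice projection `π_J(x) = Re x + J Re (J̄ x)`. -/
def piJ (J : Oct) : V →L[ℝ] V :=
  reO V + (lmo J).comp ((reO V).comp (lmo (Oct.conj J)))

variable {V}

/-- The second right associator `B_p(T, x) = T(x) p - T(x p)` of an operator. -/
def Bop (p : Oct) (T : V →L[ℝ] V) : V →L[ℝ] V := (rmo p).comp T - T.comp (rmo p)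

/-- A bounded real-linear operator is right (octonionic) para-linear if `Re B_p(T,x) = 0`. -/
def IsRightPara (T : V →L[ℝ] V) : Prop := ∀ (p : Oct) (x : V), reO V (Bop p T x) = 0

/-- The left octonionic scalar multiplication `(p ⊙ T)(x) = p T(x) + B_p(T,x)` on operators. -/
def odotL (p : Oct) (T : V →L[ℝ] V) : V →L[ℝ] V := (lmo p).comp T + Bop p T

/-- The right octonionic scalar multiplication `(T ⊙ p)(x) = T(p x) - B_p(T,x)` on operators. -/
def odotR (T : V →L[ℝ] V) (p : Oct) : V →L[ℝ] V := T.comp (lmo p) - Bop p T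

/-- The lifting map, `(lif F)(x) = ∑_i F(x ē_i) e_i`. -/
def lifO (F : V →L[ℝ] V) : V →L[ℝ] V :=
  ∑ i : Fin 8, (rmo (e i)).comp (F.comp (rmo (Oct.conj (e i))))

/-- The extension map, `(ext G)(∑ x_i e_i) = ∑ G(x_i) e_i`, where `x_i = Re (x ē_i)`. -/
def extO (G : V →L[ℝ] V) : V →L[ℝ] V :=
  ∑ i : Fin 8, (rmo (e i)).comp (G.comp ((reO V).comp (rmo (Oct.conj (e i)))))

/-- The left regular power `T^{n⊚} = lif (Re ∘ Tⁿ)`. -/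
def rpowL (T : V →L[ℝ] V) (n : ℕ) : V →L[ℝ] V := lifO ((reO V).comp (T ^ n))

/-- The right regular power `T^{⊚n} = ext (Tⁿ|_{Re V})`. -/
def rpowR (T : V →L[ℝ] V) (n : ℕ) : V →L[ℝ] V := extO (T ^ n)

/-- The regular composition `f ⊚ g = lif (Re ∘ f ∘ g)`. -/
def rcomp (f g : V →L[ℝ] V) : V →L[ℝ] V := lifO ((reO V).comp (f.comp g))

/-- The composition associator `[f,g,x]_⊚ = (f ⊚ g)(x) - f(g(x))`. -/
def compAssoc (f g : V →L[ℝ] V) (x : V) : V := rcomp f g x - f (g x)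

/-- The right regular inverse `T^{⊚-} = ext (T⁻¹|_{Re V})` of an invertible operator. -/
def rinvR (T : V →L[ℝ] V) : V →L[ℝ] V := extO (Ring.inverse T)

/-- The left regular inverse `T^{-⊚} = lif (Re ∘ T⁻¹)` of an invertible operator. -/
def rinvL (T : V →L[ℝ] V) : V →L[ℝ] V := lifO ((reO V).comp (Ring.inverse T))

/-- An operator is power-associative if all of its (composition) powers are right
para-linear. -/
def IsPowerAssoc (T : V →L[ℝ] V) : Prop := ∀ n : ℕ, IsRightPara (T ^ n)

/-- A bounded operator is octonionic linear if `T(xp) = T(x)p` for all `p`. -/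
def IsOctLinear (T : V →L[ℝ] V) : Prop := ∀ (p : Oct) (x : V), T (rmo p x) = rmo p (T x)

/-- `S` is `ℂ_J`-extendable power associative: `Sⁿ(v s) = Sⁿ(v) s` for `v ∈ Re V`,
`s ∈ ℂ_J`, `n ≥ 1`. -/
def CJExtPA (J : Oct) (S : V →L[ℝ] V) : Prop :=
  ∀ n : ℕ, 1 ≤ n → ∀ v ∈ ReSet V, ∀ s ∈ sliceC J, (S ^ n) (rmo s v) = rmo s ((S ^ n) v)

/-- `S` is `ℂ_J`-liftable power associative: `Re (Sⁿ(v s)) = Re (Sⁿ(v) s)` for all `v ∈ V`,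
`s ∈ ℂ_J`, `n ≥ 1`. -/
def CJLiftPA (J : Oct) (S : V →L[ℝ] V) : Prop :=
  ∀ n : ℕ, 1 ≤ n → ∀ (v : V), ∀ s ∈ sliceC J,
    reO V ((S ^ n) (rmo s v)) = reO V (rmo s ((S ^ n) v))

/-- The pull-back slice-resolvent set `ρ*_J(T)`. -/
def pbResSlice (T : V →L[ℝ] V) (J : Oct) : Set Oct :=
  {s | s ∈ sliceC J ∧ IsUnit ((rmo s : V →L[ℝ] V) - T) ∧
    CJExtPA J (Ring.inverse ((rmo s : V →L[ℝ] V) - T))}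

/-- The pull-back resolvent set `ρ*(T)`. -/
def pbRes (T : V →L[ℝ] V) : Set Oct := ⋃ J ∈ unitSphere, pbResSlice T J

/-- The pull-back spectrum `σ*(T) = 𝕆 ∖ ρ*(T)`. -/
def pbSpec (T : V →L[ℝ] V) : Set Oct := Set.univ \ pbRes T

/-- The push-forward slice-resolvent set `ρ_{*J}(T)`. -/
def pfResSlice (T : V →L[ℝ] V) (J : Oct) : Set Oct :=
  {s | s ∈ sliceC J ∧ IsUnit ((rmo s : V →L[ℝ] V) - T) ∧
    CJLiftPA J (Ring.inverse ((rmo s : V →L[ℝ] V) - T))}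

/-- The push-forward resolvent set `ρ_*(T)`. -/
def pfRes (T : V →L[ℝ] V) : Set Oct := ⋃ J ∈ unitSphere, pfResSlice T J

/-- The push-forward spectrum `σ_*(T) = 𝕆 ∖ ρ_*(T)`. -/
def pfSpec (T : V →L[ℝ] V) : Set Oct := Set.univ \ pfRes T

/-- The real-part projection of the `𝕆`-bimodule `𝓑_RO(V)` of bounded right para-linear
operators, given by `Re A = (5/12) A - (1/12) ∑_{i=1}^7 (e_i ⊙ A) ⊙ e_i`. -/
def reOpB (A : V →L[ℝ] V) : V →L[ℝ] V :=
  (5 / 12 : ℝ) • A - (1 / 12 : ℝ) • ∑ i : Fin 7, odotR (odotL (e i.succ) A) (e i.succ)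

end OctMod

/-- A set `U ⊆ 𝕆` is slice-open if `U ∩ ℂ_J` is open in `ℂ_J` for every `J ∈ 𝕊`. -/
def SliceOpen (U : Set Oct) : Prop :=
  ∀ J ∈ unitSphere, IsOpen (Oct.toSlice J ⁻¹' U)

/-- A parametrization of the boundary `∂(U ∩ ℂ_J)` by finitely many continuously
differentiable, positively oriented Jordan curves (positivity of the orientation is encoded
through the winding numbers). -/
structure SliceContour (J : Oct) (U : Set Oct) where
  n : ℕ
  γ : Fin n → ℝ → ℂ
  smooth : ∀ i, ContDiff ℝ 1 (γ i)
  closed : ∀ i, γ i 0 = γ i 1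
  jordan : ∀ i, Set.InjOn (γ i) (Set.Ico (0 : ℝ) 1)
  image_eq : (⋃ i, γ i '' Set.Icc (0 : ℝ) 1) = frontier (Oct.toSlice J ⁻¹' U)
  winding_inside : ∀ z : ℂ, Oct.toSlice J z ∈ U →
    (∑ i, ∫ t in (0 : ℝ)..1, deriv (γ i) t / (γ i t - z)) = 2 * (Real.pi : ℂ) * Complex.I
  winding_outside : ∀ z : ℂ, Oct.toSlice J z ∉ closure U →
    (∑ i, ∫ t in (0 : ℝ)..1, deriv (γ i) t / (γ i t - z)) = 0

/-- The integral `∫_{∂(U ∩ ℂ_J)} Φ(s, ds)` along a slice contour: the integrand gets the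
point of the curve and its derivative (both in the coordinates of the slice). -/
def contourSum {J : Oct} {U : Set Oct} (Γ : SliceContour J U) {E : Type*}
    [NormedAddCommGroup E] [NormedSpace ℝ E] (Φ : ℂ → ℂ → E) : E :=
  ∑ i, ∫ t in (0 : ℝ)..1, Φ (Γ.γ i t) (deriv (Γ.γ i) t)

/-- An axially symmetric slice domain (s-domain) in `𝕆`. -/
structure IsAdmissibleDomain (U : Set Oct) : Prop where
  isOpen : IsOpen U
  isConnected : IsConnected U
  real_nonempty : (U ∩ {s : Oct | ∃ r : ℝ, s = r • (1 : Oct)}).Nonempty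
  axially : ∀ (z : ℂ), ∀ I ∈ unitSphere, ∀ J ∈ unitSphere,
    Oct.toSlice I z ∈ U → Oct.toSlice J z ∈ U
  slice_conn : ∀ J ∈ unitSphere, IsConnected (Oct.toSlice J ⁻¹' U)

section Adm

variable {V : Type*} [NormedAddCommGroup V] [NormedSpace ℝ V] [OctBimodule V]

/-- A `T`-left-admissible domain: an axially symmetric s-domain containing the pull-back
spectrum `σ*(T)`.  (The regularity of its slice boundaries is witnessed by the slice
contours used in the integrals.) -/
def LeftAdmissible (T : V →L[ℝ] V) (U : Set Oct) : Prop :=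
  IsAdmissibleDomain U ∧ pbSpec T ⊆ U

/-- A `T`-right-admissible domain: an axially symmetric s-domain containing the push-forward
spectrum `σ_*(T)`. -/
def RightAdmissible (T : V →L[ℝ] V) (U : Set Oct) : Prop :=
  IsAdmissibleDomain U ∧ pfSpec T ⊆ U

end Adm

/-- The axially symmetric set `Ω_D ⊆ 𝕆` induced by a conjugation-invariant set `D ⊆ ℂ`. -/
def OmegaD (D : Set ℂ) : Set Oct := ⋃ J ∈ unitSphere, Oct.toSlice J '' D

/-- `F` is the stem of a slice preserving slice regular function on `Ω_D`: it is holomorphic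
on the open conjugation-invariant set `D` and intertwines complex conjugation. -/
structure IsStem (D : Set ℂ) (F : ℂ → ℂ) : Prop where
  isOpen : IsOpen D
  conj_mem : ∀ z ∈ D, (starRingEnd ℂ) z ∈ D
  holo : DifferentiableOn ℂ F D
  conj_comm : ∀ z ∈ D, F ((starRingEnd ℂ) z) = (starRingEnd ℂ) (F z)

section FC

variable {V : Type*} [NormedAddCommGroup V] [NormedSpace ℝ V] [OctBimodule V]

/-- The slice integral `(1/2π) ∫_{∂(U∩ℂ_J)} (R_s - T)^{⊚-} ⊙ (ds_J f(s))` defining the left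
slice regular functional calculus of a slice preserving function with stem `F`. -/
def leftFC (T : V →L[ℝ] V) (J : Oct) {U : Set Oct} (Γ : SliceContour J U)
    (F : ℂ → ℂ) : V →L[ℝ] V :=
  (2 * Real.pi)⁻¹ • contourSum Γ fun z dz =>
    odotR (rinvR ((rmo (Oct.toSlice J z) : V →L[ℝ] V) - T))
      ((-(Oct.toSlice J dz) * J) * Oct.toSlice J (F z))

/-- The slice integral `(1/2π) ∫_{∂(U∩ℂ_J)} (f(s) ds_J) ⊙ (R_s - T)^{-⊚}` defining the right
slice regular functional calculus of a slice preserving function with stem `F`. -/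
def rightFC (T : V →L[ℝ] V) (J : Oct) {U : Set Oct} (Γ : SliceContour J U)
    (F : ℂ → ℂ) : V →L[ℝ] V :=
  (2 * Real.pi)⁻¹ • contourSum Γ fun z dz =>
    odotL (Oct.toSlice J (F z) * (-(Oct.toSlice J dz) * J))
      (rinvL ((rmo (Oct.toSlice J z) : V →L[ℝ] V) - T))

end FC

/-- The family of stems of the components, relative to `J = ∑ c_i e_i`, of a function of the
form `f₀ + f₁ • J` with `f₀, f₁` slice preserving with stems `F₀, F₁`. -/
def stemFamily (c : Fin 8 → ℝ) (F₀ F₁ : ℂ → ℂ) : Fin 8 → ℂ → ℂ :=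
  fun i z => if i = 0 then F₀ z else (c i : ℂ) * F₁ z

namespace Oct

/-- Left multiplication by an octonion, as a real-linear map. -/
def lmulLin (q : Oct) : Oct →ₗ[ℝ] Oct where
  toFun x := q * x
  map_add' x y := by
    refine Oct.ext ?_ ?_
    · show q.a * (x.a + y.a) - star (x.b + y.b) * q.b =
        (q.a * x.a - star x.b * q.b) + (q.a * y.a - star y.b * q.b)
      rw [mul_add, star_add, add_mul]; abel
    · show (x.b + y.b) * q.a + q.b * star (x.a + y.a) =
        (x.b * q.a + q.b * star x.a) + (y.b * q.a + q.b * star y.a)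
      rw [add_mul, star_add, mul_add]; abel
  map_smul' r x := by
    refine Oct.ext ?_ ?_
    · show q.a * (r • x.a) - star (r • x.b) * q.b = r • (q.a * x.a - star x.b * q.b)
      rw [mul_smul_comm, Quaternion.star_smul, smul_mul_assoc, smul_sub]
    · show (r • x.b) * q.a + q.b * star (r • x.a) = r • (x.b * q.a + q.b * star x.a)
      rw [smul_mul_assoc, Quaternion.star_smul, mul_smul_comm, smul_add]

/-- Left multiplication `L_q : x ↦ q x` as a bounded real-linear operator on `𝕆`. -/
def Lq (q : Oct) : Oct →L[ℝ] Oct := (lmulLin q).toContinuousLinearMap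

/-- The two-sphere `[q] = {Re q + |Im q| J : J ∈ 𝕊}` associated with an octonion `q`. -/
def qSphere (q : Oct) : Set Oct :=
  {s | ∃ J ∈ unitSphere, s = Oct.re q • (1 : Oct) + ‖q - Oct.re q • (1 : Oct)‖ • J}

end Oct

section CliffordRelations

variable {A : Type*} [Ring A] [Algebra ℝ A]

lemma eq_zero_of_two_mul {x : A} (h : 2 * x = 0) : x = 0 := by
  have h2 : (2 : ℝ) • x = 0 := by rw [two_smul, ← two_mul, h]
  exact (smul_eq_zero.mp h2).resolve_left two_ne_zero

/-- If `r` satisfies the commutation relations of right multiplication by `e_k` with the left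
multiplications, then it is determined by the latter. -/
lemma two_mul_right_eq {k a b c d e f r : A}
    (haa : a * a = -1) (hbb : b * b = -1) (hcc : c * c = -1) (hee : e * e = -1)
    (hkk : k * k = -1) (hrr : r * r = -1)
    (hba : b * a = -(a * b)) (hca : c * a = -(a * c)) (hda : d * a = -(a * d))
    (hea : e * a = -(a * e)) (hfa : f * a = -(a * f)) (hak : a * k = -(k * a))
    (hcb : c * b = -(b * c)) (hdb : d * b = -(b * d)) (heb : e * b = -(b * e))
    (hfb : f * b = -(b * f)) (hbk : b * k = -(k * b))
    (hdc : d * c = -(c * d)) (hec : e * c = -(c * e)) (hfc : f * c = -(c * f))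
    (hck : c * k = -(k * c)) (hed : e * d = -(d * e)) (hdk : d * k = -(k * d))
    (hfe : f * e = -(e * f)) (hek : e * k = -(k * e)) (hfk : f * k = -(k * f))
    (hra : r * a = a * r + b - k * a) (hrb : r * b = b * r - a - k * b)
    (hrc : r * c = c * r + d - k * c) (hre : r * e = e * r + f - k * e)
    (hrk : r * k = k * r) :
    2 * r = a * b + c * d + e * f - k := by
  have key : ∀ {x y z : A}, x * y = z → ∀ w, x * (y * w) = z * w := fun h w => by
    rw [← mul_assoc, h]
  set u := c * d + e * f with hu
  set D := 2 * r - (a * b + u - k) with hD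
  set y := b + a * k with hy
  obtain ⟨hDb, hDc, hDe, hDy, huy, hv, hyce, huce, hce, hyc, hyr⟩ :
      D * b = b * D ∧ D * c = c * D ∧ D * e = e * D ∧ D * y = y * D ∧ u * y = y * u ∧
      (a * b - k) * y + y * (a * b - k) = 0 ∧ y * (c * e) = c * e * y ∧
      u * (c * e) = -(c * e * u) ∧ (c * e) * (c * e) = -1 ∧ c * (b - a * k) = -(y * c) ∧
      y = r * a - a * r := by
    refine ⟨?_, ?_, ?_, ?_, ?_, ?_, ?_, ?_, ?_, ?_, ?_⟩ <;>
    simp only [hD, hu, hy, sub_mul, mul_sub, add_mul, mul_add, two_mul, mul_assoc, mul_neg,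
      neg_mul, neg_neg, mul_one, one_mul, hbb, hcc, hee, hba, hca, hda, hea, hfa, hak, hcb,
      hdb, heb, hfb, hbk, hdc, hfc, hck, hed, hfe, hek, hra, hrb, hrc, hre, key haa, key
      hcc, key hee, key hkk, key hba, key hca, key hea, key hak, key hcb, key heb, key hbk,
      key hdc, key hec, key hfc, key hck, key hdk, key hek, key hfk, key hrk] <;>
    abel
  have hry : r * y + y * r = 0 := by
    have h' : r * y + y * r = (r * r) * a - a * (r * r) := by
      rw [hyr]; noncomm_ring
    rw [h', hrr]; noncomm_ring
  have hr2 : 2 * r = D + (a * b - k) + u := by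
    rw [hD]; abel
  have h1 : (u + D) * y = 0 := by
    apply eq_zero_of_two_mul
    calc 2 * ((u + D) * y) = (D + (a * b - k) + u) * y + y * (D + (a * b - k) + u)
          - ((a * b - k) * y + y * (a * b - k)) + (u * y - y * u) + (D * y - y * D) := by
            noncomm_ring
      _ = 2 * (r * y + y * r) := by
            rw [hv, huy, hDy, ← hr2]; noncomm_ring
      _ = 0 := by rw [hry, mul_zero]
  have hDce : D * (c * e) = c * e * D := by
    rw [← mul_assoc, hDc, mul_assoc, hDe, mul_assoc]
  have h2 : (-u + D) * y = 0 := by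
    have h : (c * e) * ((-u + D) * y) = 0 := by
      calc (c * e) * ((-u + D) * y) = (-(c * e * u) + c * e * D) * y := by noncomm_ring
        _ = (u + D) * (c * e * y) := by rw [← huce, ← hDce]; noncomm_ring
        _ = 0 := by rw [← hyce, ← mul_assoc, h1, zero_mul]
    have h' := congrArg (fun t => (c * e) * t) h
    simp only [← mul_assoc (c * e) (c * e), hce, mul_zero] at h'
    simpa using h'
  have hDy0 : D * y = 0 := by
    apply eq_zero_of_two_mul
    calc 2 * (D * y) = (u + D) * y + (-u + D) * y := by noncomm_ring
      _ = 0 := by rw [h1, h2, add_zero]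
  have h3 : D * (b - a * k) = 0 := by
    have h : c * (D * (b - a * k)) = 0 := by
      rw [← mul_assoc, ← hDc, mul_assoc, hyc, mul_neg, ← mul_assoc, hDy0, zero_mul, neg_zero]
    have h' := congrArg (fun t => c * t) h
    simp only [← mul_assoc c c, hcc, mul_zero] at h'
    simpa using h'
  have h4 : D * b = 0 := by
    apply eq_zero_of_two_mul
    calc 2 * (D * b) = D * y + D * (b - a * k) := by rw [hy]; noncomm_ring
      _ = 0 := by rw [hDy0, h3, add_zero]
  have h5 : D = 0 := by
    have h : D * b * b = 0 := by rw [h4, zero_mul]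
    rw [mul_assoc, hbb] at h
    simpa using h
  rw [hr2, h5, hu]
  abel

end CliffordRelations

namespace Oct

lemma ext_coords {x y : Oct} (h0 : x.a.re = y.a.re) (h1 : x.a.imI = y.a.imI)
    (h2 : x.a.imJ = y.a.imJ) (h3 : x.a.imK = y.a.imK) (h4 : x.b.re = y.b.re)
    (h5 : x.b.imI = y.b.imI) (h6 : x.b.imJ = y.b.imJ) (h7 : x.b.imK = y.b.imK) : x = y :=
  Oct.ext (Quaternion.ext _ _ h0 h1 h2 h3) (Quaternion.ext _ _ h4 h5 h6 h7)

@[simp] lemma add_a_re (x y : Oct) : (x + y).a.re = x.a.re + y.a.re := rfl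
@[simp] lemma sub_a_re (x y : Oct) : (x - y).a.re = x.a.re - y.a.re := rfl
@[simp] lemma neg_a_re (x : Oct) : (-x).a.re = -x.a.re := rfl
@[simp] lemma smul_a_re (r : ℝ) (x : Oct) : (r • x).a.re = r * x.a.re := rfl
@[simp] lemma zero_a_re : (0 : Oct).a.re = 0 := rfl
@[simp] lemma one_a_re : (1 : Oct).a.re = 1 := rfl
@[simp] lemma conj_a_re (x : Oct) : (conj x).a.re = x.a.re := Quaternion.re_star x.a

@[simp] lemma add_a_imI (x y : Oct) : (x + y).a.imI = x.a.imI + y.a.imI := rfl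
@[simp] lemma sub_a_imI (x y : Oct) : (x - y).a.imI = x.a.imI - y.a.imI := rfl
@[simp] lemma neg_a_imI (x : Oct) : (-x).a.imI = -x.a.imI := rfl
@[simp] lemma smul_a_imI (r : ℝ) (x : Oct) : (r • x).a.imI = r * x.a.imI := rfl
@[simp] lemma zero_a_imI : (0 : Oct).a.imI = 0 := rfl
@[simp] lemma one_a_imI : (1 : Oct).a.imI = 0 := rfl
@[simp] lemma conj_a_imI (x : Oct) : (conj x).a.imI = -x.a.imI := rfl

@[simp] lemma add_a_imJ (x y : Oct) : (x + y).a.imJ = x.a.imJ + y.a.imJ := rfl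
@[simp] lemma sub_a_imJ (x y : Oct) : (x - y).a.imJ = x.a.imJ - y.a.imJ := rfl
@[simp] lemma neg_a_imJ (x : Oct) : (-x).a.imJ = -x.a.imJ := rfl
@[simp] lemma smul_a_imJ (r : ℝ) (x : Oct) : (r • x).a.imJ = r * x.a.imJ := rfl
@[simp] lemma zero_a_imJ : (0 : Oct).a.imJ = 0 := rfl
@[simp] lemma one_a_imJ : (1 : Oct).a.imJ = 0 := rfl
@[simp] lemma conj_a_imJ (x : Oct) : (conj x).a.imJ = -x.a.imJ := rfl

@[simp] lemma add_a_imK (x y : Oct) : (x + y).a.imK = x.a.imK + y.a.imK := rfl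
@[simp] lemma sub_a_imK (x y : Oct) : (x - y).a.imK = x.a.imK - y.a.imK := rfl
@[simp] lemma neg_a_imK (x : Oct) : (-x).a.imK = -x.a.imK := rfl
@[simp] lemma smul_a_imK (r : ℝ) (x : Oct) : (r • x).a.imK = r * x.a.imK := rfl
@[simp] lemma zero_a_imK : (0 : Oct).a.imK = 0 := rfl
@[simp] lemma one_a_imK : (1 : Oct).a.imK = 0 := rfl
@[simp] lemma conj_a_imK (x : Oct) : (conj x).a.imK = -x.a.imK := rfl

@[simp] lemma add_b_re (x y : Oct) : (x + y).b.re = x.b.re + y.b.re := rfl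
@[simp] lemma sub_b_re (x y : Oct) : (x - y).b.re = x.b.re - y.b.re := rfl
@[simp] lemma neg_b_re (x : Oct) : (-x).b.re = -x.b.re := rfl
@[simp] lemma smul_b_re (r : ℝ) (x : Oct) : (r • x).b.re = r * x.b.re := rfl
@[simp] lemma zero_b_re : (0 : Oct).b.re = 0 := rfl
@[simp] lemma one_b_re : (1 : Oct).b.re = 0 := rfl
@[simp] lemma conj_b_re (x : Oct) : (conj x).b.re = -x.b.re := rfl

@[simp] lemma add_b_imI (x y : Oct) : (x + y).b.imI = x.b.imI + y.b.imI := rfl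
@[simp] lemma sub_b_imI (x y : Oct) : (x - y).b.imI = x.b.imI - y.b.imI := rfl
@[simp] lemma neg_b_imI (x : Oct) : (-x).b.imI = -x.b.imI := rfl
@[simp] lemma smul_b_imI (r : ℝ) (x : Oct) : (r • x).b.imI = r * x.b.imI := rfl
@[simp] lemma zero_b_imI : (0 : Oct).b.imI = 0 := rfl
@[simp] lemma one_b_imI : (1 : Oct).b.imI = 0 := rfl
@[simp] lemma conj_b_imI (x : Oct) : (conj x).b.imI = -x.b.imI := rfl

@[simp] lemma add_b_imJ (x y : Oct) : (x + y).b.imJ = x.b.imJ + y.b.imJ := rfl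
@[simp] lemma sub_b_imJ (x y : Oct) : (x - y).b.imJ = x.b.imJ - y.b.imJ := rfl
@[simp] lemma neg_b_imJ (x : Oct) : (-x).b.imJ = -x.b.imJ := rfl
@[simp] lemma smul_b_imJ (r : ℝ) (x : Oct) : (r • x).b.imJ = r * x.b.imJ := rfl
@[simp] lemma zero_b_imJ : (0 : Oct).b.imJ = 0 := rfl
@[simp] lemma one_b_imJ : (1 : Oct).b.imJ = 0 := rfl
@[simp] lemma conj_b_imJ (x : Oct) : (conj x).b.imJ = -x.b.imJ := rfl

@[simp] lemma add_b_imK (x y : Oct) : (x + y).b.imK = x.b.imK + y.b.imK := rfl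
@[simp] lemma sub_b_imK (x y : Oct) : (x - y).b.imK = x.b.imK - y.b.imK := rfl
@[simp] lemma neg_b_imK (x : Oct) : (-x).b.imK = -x.b.imK := rfl
@[simp] lemma smul_b_imK (r : ℝ) (x : Oct) : (r • x).b.imK = r * x.b.imK := rfl
@[simp] lemma zero_b_imK : (0 : Oct).b.imK = 0 := rfl
@[simp] lemma one_b_imK : (1 : Oct).b.imK = 0 := rfl
@[simp] lemma conj_b_imK (x : Oct) : (conj x).b.imK = -x.b.imK := rfl

section

open scoped Quaternion

@[simp] lemma mul_a_re (x y : Oct) :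
    (x * y).a.re =
      x.a.re * y.a.re - x.a.imI * y.a.imI - x.a.imJ * y.a.imJ - x.a.imK * y.a.imK - x.b.re
        * y.b.re - x.b.imI * y.b.imI - x.b.imJ * y.b.imJ - x.b.imK * y.b.imK := by
  change (x.a * y.a - star y.b * x.b).re = _
  simp
  ring

@[simp] lemma mul_a_imI (x y : Oct) :
    (x * y).a.imI =
      x.a.re * y.a.imI + x.a.imI * y.a.re + x.a.imJ * y.a.imK + x.b.re * y.b.imI + x.b.imK
        * y.b.imJ - x.a.imK * y.a.imJ - x.b.imI * y.b.re - x.b.imJ * y.b.imK := by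
  change (x.a * y.a - star y.b * x.b).imI = _
  simp
  ring

@[simp] lemma mul_a_imJ (x y : Oct) :
    (x * y).a.imJ =
      x.a.re * y.a.imJ + x.a.imJ * y.a.re + x.a.imK * y.a.imI + x.b.re * y.b.imJ + x.b.imI
        * y.b.imK - x.a.imI * y.a.imK - x.b.imJ * y.b.re - x.b.imK * y.b.imI := by
  change (x.a * y.a - star y.b * x.b).imJ = _
  simp
  ring

@[simp] lemma mul_a_imK (x y : Oct) :
    (x * y).a.imK =
      x.a.re * y.a.imK + x.a.imI * y.a.imJ + x.a.imK * y.a.re + x.b.imJ * y.b.imI + x.b.re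
        * y.b.imK - x.a.imJ * y.a.imI - x.b.imK * y.b.re - x.b.imI * y.b.imJ := by
  change (x.a * y.a - star y.b * x.b).imK = _
  simp
  ring

@[simp] lemma mul_b_re (x y : Oct) :
    (x * y).b.re =
      x.a.re * y.b.re + x.b.re * y.a.re + x.b.imI * y.a.imI + x.b.imJ * y.a.imJ + x.b.imK
        * y.a.imK - x.a.imI * y.b.imI - x.a.imJ * y.b.imJ - x.a.imK * y.b.imK := by
  change (y.b * x.a + x.b * star y.a).re = _
  simp
  ring

@[simp] lemma mul_b_imI (x y : Oct) :
    (x * y).b.imI =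
      x.a.imI * y.b.re + x.a.re * y.b.imI + x.a.imK * y.b.imJ + x.b.imI * y.a.re + x.b.imK
        * y.a.imJ - x.a.imJ * y.b.imK - x.b.re * y.a.imI - x.b.imJ * y.a.imK := by
  change (y.b * x.a + x.b * star y.a).imI = _
  simp
  ring

@[simp] lemma mul_b_imJ (x y : Oct) :
    (x * y).b.imJ =
      x.a.imJ * y.b.re + x.a.re * y.b.imJ + x.a.imI * y.b.imK + x.b.imI * y.a.imK +
        x.b.imJ * y.a.re - x.a.imK * y.b.imI - x.b.re * y.a.imJ - x.b.imK * y.a.imI := by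
  change (y.b * x.a + x.b * star y.a).imJ = _
  simp
  ring

@[simp] lemma mul_b_imK (x y : Oct) :
    (x * y).b.imK =
      x.a.imK * y.b.re + x.a.imJ * y.b.imI + x.a.re * y.b.imK + x.b.imJ * y.a.imI +
        x.b.imK * y.a.re - x.a.imI * y.b.imJ - x.b.re * y.a.imK - x.b.imI * y.a.imJ := by
  change (y.b * x.a + x.b * star y.a).imK = _
  simp
  ring

end

protected lemma mul_neg (x y : Oct) : x * -y = -(x * y) := by
  apply ext_coords <;> simp <;> ring

protected lemma neg_mul (x y : Oct) : -x * y = -(x * y) := by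
  apply ext_coords <;> simp <;> ring

section

open scoped Quaternion

lemma e_mul_self {i : Fin 8} (hi : i ≠ 0) : e i * e i = -1 := by
  fin_cases i
  · exact absurd rfl hi
  all_goals apply ext_coords <;> simp [e, eNat]

lemma e_mul_e_comm {i j : Fin 8} (hi : i ≠ 0) (hj : j ≠ 0) (hij : i ≠ j) :
    e i * e j = -(e j * e i) := by
  fin_cases i <;> fin_cases j <;>
    first
    | exact absurd rfl hi
    | exact absurd rfl hj
    | exact absurd rfl hij
    | (apply ext_coords <;> simp [e, eNat])

/-- A positively oriented line `e_a e_b = e_k` of the Fano plane. -/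
def IsLine (a b k : Fin 8) : Prop := e a * e b = e k ∧ e b * e k = e a ∧ e k * e a = e b

lemma IsLine.rotate {a b k : Fin 8} (h : IsLine a b k) : IsLine b k a := ⟨h.2.1, h.2.2, h.1⟩

lemma isLine_123 : IsLine 1 2 3 := by refine ⟨?_, ?_, ?_⟩ <;> apply ext_coords <;> simp [e, eNat]
lemma isLine_145 : IsLine 1 4 5 := by refine ⟨?_, ?_, ?_⟩ <;> apply ext_coords <;> simp [e, eNat]
lemma isLine_176 : IsLine 1 7 6 := by refine ⟨?_, ?_, ?_⟩ <;> apply ext_coords <;> simp [e, eNat]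
lemma isLine_246 : IsLine 2 4 6 := by refine ⟨?_, ?_, ?_⟩ <;> apply ext_coords <;> simp [e, eNat]
lemma isLine_257 : IsLine 2 5 7 := by refine ⟨?_, ?_, ?_⟩ <;> apply ext_coords <;> simp [e, eNat]
lemma isLine_347 : IsLine 3 4 7 := by refine ⟨?_, ?_, ?_⟩ <;> apply ext_coords <;> simp [e, eNat]
lemma isLine_365 : IsLine 3 6 5 := by refine ⟨?_, ?_, ?_⟩ <;> apply ext_coords <;> simp [e, eNat]

end

end Oct

section Multiplications

variable {V : Type*} [NormedAddCommGroup V] [NormedSpace ℝ V] [OctBimodule V]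

variable (V) in
lemma lmo_neg (p : Oct) : (lmo (-p) : V →L[ℝ] V) = -lmo p := map_neg OctBimodule.lm p

variable (V) in
lemma rmo_neg (p : Oct) : (rmo (-p) : V →L[ℝ] V) = -rmo p := map_neg OctBimodule.rm p

variable (V) in
lemma lmo_one : (lmo 1 : V →L[ℝ] V) = 1 := ContinuousLinearMap.ext OctBimodule.lm_one

variable (V) in
lemma rmo_one : (rmo 1 : V →L[ℝ] V) = 1 := ContinuousLinearMap.ext OctBimodule.rm_one

variable (V) in
lemma left_assoc_eq_mid_assoc (p q : Oct) :
    (lmo (p * q) : V →L[ℝ] V) - lmo p * lmo q = rmo p * lmo q - lmo q * rmo p :=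
  ContinuousLinearMap.ext (OctBimodule.assoc_cyc₁ p q)

variable (V) in
lemma left_assoc_eq_right_assoc (p q : Oct) :
    (lmo (p * q) : V →L[ℝ] V) - lmo p * lmo q = rmo q * rmo p - rmo (p * q) :=
  ContinuousLinearMap.ext (OctBimodule.assoc_cyc₂ p q)

variable (V) in
lemma left_assoc_swap (p q : Oct) :
    (lmo (p * q) : V →L[ℝ] V) - lmo p * lmo q = -(lmo (q * p) - lmo q * lmo p) :=
  ContinuousLinearMap.ext (OctBimodule.assoc_alt p q)

variable (V) in
lemma lmo_mul_self_eq (p : Oct) : (lmo (p * p) : V →L[ℝ] V) = lmo p * lmo p := by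
  have h := left_assoc_swap V p p
  refine sub_eq_zero.mp (eq_zero_of_two_mul ?_)
  rw [two_mul]
  nth_rewrite 1 [h]
  exact neg_add_cancel _

variable (V) in
lemma rmo_mul_self_eq (p : Oct) : (rmo (p * p) : V →L[ℝ] V) = rmo p * rmo p := by
  have h := left_assoc_eq_right_assoc V p p
  rw [lmo_mul_self_eq, sub_self] at h
  exact (sub_eq_zero.mp h.symm).symm

variable (V) in
lemma rmo_mul_lmo_self (p : Oct) : (rmo p : V →L[ℝ] V) * lmo p = lmo p * rmo p := by
  have h := left_assoc_eq_mid_assoc V p p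
  rw [lmo_mul_self_eq, sub_self] at h
  exact sub_eq_zero.mp h.symm

variable (V) in
lemma lmo_mul_self {p : Oct} (hp : p * p = -1) : (lmo p : V →L[ℝ] V) * lmo p = -1 := by
  rw [← lmo_mul_self_eq, hp, lmo_neg, lmo_one]

variable (V) in
lemma rmo_mul_self {p : Oct} (hp : p * p = -1) : (rmo p : V →L[ℝ] V) * rmo p = -1 := by
  rw [← rmo_mul_self_eq, hp, rmo_neg, rmo_one]

variable (V) in
lemma lmo_mul_comm {p q : Oct} (h : p * q = -(q * p)) :
    (lmo p : V →L[ℝ] V) * lmo q = -(lmo q * lmo p) := by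
  have h1 := left_assoc_swap V p q
  rw [h, lmo_neg] at h1
  linear_combination (norm := abel) -h1

variable (V) in
lemma rmo_mul_comm {p q : Oct} (h : p * q = -(q * p)) :
    (rmo p : V →L[ℝ] V) * rmo q = -(rmo q * rmo p) := by
  have h1 := left_assoc_swap V p q
  rw [left_assoc_eq_right_assoc, left_assoc_eq_right_assoc, h, rmo_neg] at h1
  linear_combination (norm := abel) h1

variable (V) in
/-- The Moufang identity `p(qx)p = (pq)(xp)` for anticommuting imaginary units `p`, `q`. -/
lemma rmo_lmo_mul_lmo {p q m : Oct} (hp : p * p = -1) (hpq : p * q = m) (hpm : p * m = -q)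
    (h : p * q = -(q * p)) (h' : p * m = -(m * p)) :
    (rmo p : V →L[ℝ] V) * lmo p * lmo q = lmo m * rmo p := by
  have e1 := left_assoc_eq_mid_assoc V p m
  have e2 := left_assoc_eq_right_assoc V p m
  have e3 := left_assoc_eq_right_assoc V p q
  rw [hpm, lmo_neg] at e1 e2
  rw [rmo_neg] at e2
  rw [hpq] at e3
  have e4 := rmo_mul_comm V h
  have e5 := rmo_mul_comm V h'
  have e6 := rmo_mul_self V hp
  have e7 : (rmo p : V →L[ℝ] V) * (rmo p * rmo q) = -rmo q := by rw [← mul_assoc, e6]; simp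
  have e8 : (rmo p : V →L[ℝ] V) * (rmo q * rmo p) = rmo q := by
    rw [← neg_eq_iff_eq_neg.mpr e4]; simp [e7]
  have e9 := congrArg (fun t => (rmo p : V →L[ℝ] V) * t) e3
  simp only [mul_sub, e8] at e9
  rw [mul_assoc]
  linear_combination (norm := abel) e2 - e1 - e9 + e5

variable (V) in
/-- The Moufang identity `p(xq)p = (px)(qp)` for anticommuting imaginary units `p`, `q`. -/
lemma rmo_lmo_mul_rmo {p q m : Oct} (hp : p * p = -1) (hpq : p * q = m) (hpm : p * m = -q)
    (h : p * q = -(q * p)) (h' : p * m = -(m * p)) :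
    (rmo p : V →L[ℝ] V) * lmo p * rmo q = -(rmo m * lmo p) := by
  have hqp : q * p = -m := by rw [← hpq, h, neg_neg]
  have hmp : m * p = q := by rw [← neg_neg (m * p), ← h', hpm, neg_neg]
  have e1 := left_assoc_eq_right_assoc V q p
  have e2 := left_assoc_eq_mid_assoc V m p
  have e3 := lmo_mul_comm V h'
  have e4 : (lmo p : V →L[ℝ] V) * (lmo q * lmo p) = lmo q := by
    rw [← neg_eq_iff_eq_neg.mpr (lmo_mul_comm V h), mul_neg, ← mul_assoc, lmo_mul_self V hp]
    simp
  rw [hqp, lmo_neg, rmo_neg] at e1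
  rw [hmp] at e2
  have e5 := congrArg (fun t => (lmo p : V →L[ℝ] V) * t) e1
  simp only [mul_sub, mul_neg, e4] at e5
  rw [rmo_mul_lmo_self, mul_assoc]
  linear_combination (norm := abel) -e5 - e2 - e3

variable (V) in
lemma sub_mul_rmo_lmo {p q m : Oct} (hp : p * p = -1) (hpq : p * q = m) (hpm : p * m = -q)
    (h : p * q = -(q * p)) (h' : p * m = -(m * p)) :
    ((lmo q : V →L[ℝ] V) - rmo q) * (rmo p * lmo p) =
      lmo q - rmo q - (lmo m + rmo m) * (lmo p + rmo p) := by
  have hqp : q * p = -m := by rw [← hpq, h, neg_neg]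
  have e1 := left_assoc_eq_mid_assoc V p q
  have e2 := left_assoc_eq_mid_assoc V q p
  have e3 := left_assoc_eq_right_assoc V q p
  rw [hpq] at e1
  rw [hqp, lmo_neg] at e2 e3
  rw [rmo_neg] at e3
  have f1 := rmo_lmo_mul_lmo V hp hpq hpm h h'
  have f2 := rmo_lmo_mul_rmo V hp hpq hpm h h'
  have c1 := lmo_mul_comm V h
  have c2 := rmo_mul_comm V h
  have s1 := lmo_mul_self V hp
  have s2 := rmo_mul_self V hp
  have g1 : (lmo q : V →L[ℝ] V) * (rmo p * lmo p) = lmo q - lmo m * (rmo p + lmo p) := by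
    have t : (lmo q : V →L[ℝ] V) * rmo p = rmo p * lmo q - lmo m + lmo p * lmo q := by
      linear_combination (norm := abel) e1
    rw [← mul_assoc, t, add_mul, sub_mul, c1, neg_mul, mul_assoc (lmo q), s1, mul_assoc (rmo p),
      ← neg_eq_iff_eq_neg.mpr c1, mul_neg, ← mul_assoc, f1]
    noncomm_ring
  have g2 : (rmo q : V →L[ℝ] V) * (rmo p * lmo p) = rmo q + rmo m * (lmo p + rmo p) := by
    have t : (rmo q : V →L[ℝ] V) * lmo p = lmo p * rmo q - rmo q * rmo p + rmo m := by
      linear_combination (norm := abel) e3 - e2 + c2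
    rw [rmo_mul_lmo_self, ← mul_assoc, t, add_mul, sub_mul, mul_assoc (rmo q), s2,
      mul_assoc (lmo p), ← neg_eq_iff_eq_neg.mpr c2, mul_neg, ← mul_assoc, ← rmo_mul_lmo_self, f2]
    noncomm_ring
  rw [sub_mul, g1, g2]
  noncomm_ring

end Multiplications

section RealPart

variable {V : Type*} [NormedAddCommGroup V] [NormedSpace ℝ V] [OctBimodule V]

lemma Oct.IsLine.mul_swap {a b k : Fin 8} (h : IsLine a b k) (ha : a ≠ 0) (hb : b ≠ 0)
    (hab : a ≠ b) : e b * e a = -e k := by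
  rw [e_mul_e_comm hb ha hab.symm, h.1]

variable (V) in
lemma sub_mul_add_of_isLine {a b k : Fin 8} (h : IsLine a b k) (ha : a ≠ 0) (hb : b ≠ 0)
    (hk : k ≠ 0) (hab : a ≠ b) (hak : a ≠ k) (hbk : b ≠ k) :
    ((lmo (e k) : V →L[ℝ] V) - rmo (e k)) *
        (rmo (e a) * lmo (e a) + rmo (e b) * lmo (e b)) =
      2 * (lmo (e k) - lmo (e a) * lmo (e b)) := by
  have hak' : e a * e k = -e b := h.rotate.rotate.mul_swap hk ha hak.symm
  have hba' : e b * e a = -e k := h.mul_swap ha hb hab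
  have e1 := sub_mul_rmo_lmo V (q := e k) (m := -e b) (e_mul_self ha) hak'
    (by rw [Oct.mul_neg, h.1]) (e_mul_e_comm ha hk hak)
    (by rw [Oct.mul_neg, Oct.neg_mul, e_mul_e_comm ha hb hab])
  have e2 := sub_mul_rmo_lmo V (q := e k) (m := e a) (e_mul_self hb) h.2.1 hba'
    (e_mul_e_comm hb hk hbk) (e_mul_e_comm hb ha hab.symm)
  have m1 := left_assoc_eq_mid_assoc V (e a) (e b)
  have m2 := left_assoc_eq_mid_assoc V (e b) (e a)
  have r1 := left_assoc_eq_right_assoc V (e a) (e b)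
  have r2 := left_assoc_eq_right_assoc V (e b) (e a)
  rw [h.1] at m1 r1
  rw [hba', lmo_neg] at m2 r2
  rw [rmo_neg] at r2
  rw [mul_add, e1, e2, lmo_neg, rmo_neg, two_mul]
  simp only [add_mul, mul_add, neg_mul]
  linear_combination (norm := abel) m1 - m2 - r1 + r2 +
    lmo_mul_comm V (e_mul_e_comm hb ha hab.symm)

variable (V) in
lemma sub_mul_sum_rmo_lmo (n : Fin 7 → Fin 8) (hn : Function.Injective n) (h0 : ∀ i, n i ≠ 0)
    (h12 : IsLine (n 1) (n 2) (n 0)) (h34 : IsLine (n 3) (n 4) (n 0))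
    (h56 : IsLine (n 5) (n 6) (n 0)) :
    ((lmo (e (n 0)) : V →L[ℝ] V) - rmo (e (n 0))) *
        ∑ i : Fin 7, rmo (e i.succ) * lmo (e i.succ) =
      5 * (lmo (e (n 0)) - rmo (e (n 0))) := by
  have hne : ∀ {i j : Fin 7}, i ≠ j → n i ≠ n j := fun h => hn.ne h
  have hsum : ∑ i : Fin 7, (rmo (e i.succ) : V →L[ℝ] V) * lmo (e i.succ) =
      ∑ i : Fin 7, rmo (e (n i)) * lmo (e (n i)) := by
    have hinj : Function.Injective fun i => (n i).pred (h0 i) := fun i j hij =>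
      hn (Fin.pred_inj.mp hij)
    rw [← (Finite.injective_iff_bijective.mp hinj).sum_comp]
    simp only [Fin.succ_pred]
  have hsq : ∀ i, (lmo (e (n i)) : V →L[ℝ] V) * lmo (e (n i)) = -1 := fun i =>
    lmo_mul_self V (e_mul_self (h0 i))
  have hanti : ∀ i j, i ≠ j → (lmo (e (n i)) : V →L[ℝ] V) * lmo (e (n j)) =
      -(lmo (e (n j)) * lmo (e (n i))) := fun i j hij =>
    lmo_mul_comm V (e_mul_e_comm (h0 i) (h0 j) (hne hij))
  have hmid : ∀ i j, IsLine (n i) (n j) (n 0) → i ≠ j → i ≠ 0 → j ≠ 0 →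
      (rmo (e (n 0)) : V →L[ℝ] V) * lmo (e (n i)) =
        lmo (e (n i)) * rmo (e (n 0)) + lmo (e (n j)) - lmo (e (n 0)) * lmo (e (n i)) ∧
      (rmo (e (n 0)) : V →L[ℝ] V) * lmo (e (n j)) =
        lmo (e (n j)) * rmo (e (n 0)) - lmo (e (n i)) - lmo (e (n 0)) * lmo (e (n j)) := by
    intro i j hl hij hi hj
    have m1 := left_assoc_eq_mid_assoc V (e (n 0)) (e (n i))
    have m2 := left_assoc_eq_mid_assoc V (e (n 0)) (e (n j))
    rw [hl.2.2] at m1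
    rw [hl.rotate.mul_swap (h0 j) (h0 0) (hne hj), lmo_neg] at m2
    exact ⟨by linear_combination (norm := abel) -m1, by linear_combination (norm := abel) -m2⟩
  obtain ⟨q1, q2⟩ := hmid 1 2 h12 (by decide) (by decide) (by decide)
  obtain ⟨q3, q4⟩ := hmid 3 4 h34 (by decide) (by decide) (by decide)
  obtain ⟨q5, q6⟩ := hmid 5 6 h56 (by decide) (by decide) (by decide)
  have key := two_mul_right_eq (hsq 1) (hsq 2) (hsq 3) (hsq 5) (hsq 0)
    (rmo_mul_self V (e_mul_self (h0 0)))
    (hanti 2 1 (by decide)) (hanti 3 1 (by decide)) (hanti 4 1 (by decide))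
    (hanti 5 1 (by decide)) (hanti 6 1 (by decide)) (hanti 1 0 (by decide))
    (hanti 3 2 (by decide)) (hanti 4 2 (by decide)) (hanti 5 2 (by decide))
    (hanti 6 2 (by decide)) (hanti 2 0 (by decide))
    (hanti 4 3 (by decide)) (hanti 5 3 (by decide)) (hanti 6 3 (by decide))
    (hanti 3 0 (by decide)) (hanti 5 4 (by decide)) (hanti 4 0 (by decide))
    (hanti 6 5 (by decide)) (hanti 5 0 (by decide)) (hanti 6 0 (by decide))
    q1 q2 q3 q5 (rmo_mul_lmo_self V _)
  have l1 := sub_mul_add_of_isLine V h12 (h0 _) (h0 _) (h0 _) (hne (by decide))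
    (hne (by decide)) (hne (by decide))
  have l2 := sub_mul_add_of_isLine V h34 (h0 _) (h0 _) (h0 _) (hne (by decide))
    (hne (by decide)) (hne (by decide))
  have l3 := sub_mul_add_of_isLine V h56 (h0 _) (h0 _) (h0 _) (hne (by decide))
    (hne (by decide)) (hne (by decide))
  have l0 : ((lmo (e (n 0)) : V →L[ℝ] V) - rmo (e (n 0))) * (rmo (e (n 0)) * lmo (e (n 0))) =
      lmo (e (n 0)) - rmo (e (n 0)) := by
    rw [sub_mul, ← mul_assoc (rmo _), rmo_mul_self V (e_mul_self (h0 0)), rmo_mul_lmo_self,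
      ← mul_assoc, hsq]
    simp [neg_add_eq_sub]
  rw [hsum, Fin.sum_univ_seven]
  simp only [mul_add] at l1 l2 l3 ⊢
  linear_combination (norm := noncomm_ring) l0 + l1 + l2 + l3 + 2 * key

variable (V) in
lemma lmo_mul_reO_eq (k : Fin 7) :
    (lmo (e k.succ) : V →L[ℝ] V) * reO V = rmo (e k.succ) * reO V := by
  have h : ((lmo (e k.succ) : V →L[ℝ] V) - rmo (e k.succ)) *
        ∑ i : Fin 7, rmo (e i.succ) * lmo (e i.succ) =
      5 * (lmo (e k.succ) - rmo (e k.succ)) := by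
    fin_cases k
    · exact sub_mul_sum_rmo_lmo V ![1, 2, 3, 4, 5, 7, 6] (by decide) (by decide)
        isLine_123.rotate isLine_145.rotate isLine_176.rotate
    · exact sub_mul_sum_rmo_lmo V ![2, 3, 1, 4, 6, 5, 7] (by decide) (by decide)
        isLine_123.rotate.rotate isLine_246.rotate isLine_257.rotate
    · exact sub_mul_sum_rmo_lmo V ![3, 1, 2, 4, 7, 6, 5] (by decide) (by decide)
        isLine_123 isLine_347.rotate isLine_365.rotate
    · exact sub_mul_sum_rmo_lmo V ![4, 5, 1, 6, 2, 7, 3] (by decide) (by decide)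
        isLine_145.rotate.rotate isLine_246.rotate.rotate isLine_347.rotate.rotate
    · exact sub_mul_sum_rmo_lmo V ![5, 1, 4, 7, 2, 3, 6] (by decide) (by decide)
        isLine_145 isLine_257.rotate.rotate isLine_365
    · exact sub_mul_sum_rmo_lmo V ![6, 1, 7, 2, 4, 5, 3] (by decide) (by decide)
        isLine_176 isLine_246 isLine_365.rotate.rotate
    · exact sub_mul_sum_rmo_lmo V ![7, 6, 1, 2, 5, 3, 4] (by decide) (by decide)
        isLine_176.rotate.rotate isLine_257 isLine_347
  have hre : reO V = (5 / 12 : ℝ) • (1 : V →L[ℝ] V) -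
      (1 / 12 : ℝ) • ∑ i : Fin 7, rmo (e i.succ) * lmo (e i.succ) := rfl
  rw [← sub_eq_zero, ← sub_mul, hre, mul_sub, mul_smul_comm, mul_smul_comm, h, mul_one]
  have h5 : (5 : V →L[ℝ] V) * (lmo (e k.succ) - rmo (e k.succ)) =
      (5 : ℝ) • (lmo (e k.succ) - rmo (e k.succ)) := by
    rw [ofNat_smul_eq_nsmul ℝ, nsmul_eq_mul]
    rfl
  rw [h5]
  module

end RealPart

namespace Oct

section

open scoped Quaternion

lemma linearMap_ext {W : Type*} [AddCommGroup W] [Module ℝ W] {f g : Oct →ₗ[ℝ] W}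
    (h1 : f 1 = g 1) (h : ∀ k : Fin 7, f (e k.succ) = g (e k.succ)) : f = g := by
  refine LinearMap.ext fun p => ?_
  have hp : p = p.a.re • (1 : Oct) + p.a.imI • e 1 + p.a.imJ • e 2 + p.a.imK • e 3 +
      p.b.re • e 4 + p.b.imI • e 5 + p.b.imJ • e 6 + p.b.imK • e 7 := by
    apply ext_coords <;> simp [e, eNat]
  rw [hp]
  simp only [map_add, map_smul, h1, show f (e 1) = g (e 1) from h 0,
    show f (e 2) = g (e 2) from h 1, show f (e 3) = g (e 3) from h 2,
    show f (e 4) = g (e 4) from h 3, show f (e 5) = g (e 5) from h 4,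
    show f (e 6) = g (e 6) from h 5, show f (e 7) = g (e 7) from h 6]

lemma sub_sum_e_mul_mul_e (p : Oct) :
    (5 / 12 : ℝ) • p - (1 / 12 : ℝ) • ∑ i : Fin 7, (e i.succ * p) * e i.succ =
      p.a.re • (1 : Oct) := by
  rw [Fin.sum_univ_seven]
  apply ext_coords <;> simp [e, eNat] <;> ring

lemma sum_re_mul_e_smul_conj (p : Oct) :
    ∑ i : Fin 8, (p * e i).a.re • conj (e i) = p := by
  rw [Fin.sum_univ_eight]
  apply ext_coords <;> simp [e, eNat]

lemma eq_re_smul_one_of_assoc {x : Oct} (h : ∀ p q : Oct, x * (p * q) = (x * p) * q) :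
    x = x.a.re • (1 : Oct) := by
  have h12 := h (e 1) (e 2)
  have h14 := h (e 1) (e 4)
  have h24 := h (e 2) (e 4)
  have c : ∀ {y z : Oct} (_ : y = z) (f : Oct → ℝ), f y = f z := fun h f => congrArg f h
  have k1 := c h12 (fun y => y.b.re)
  have k2 := c h12 (fun y => y.b.imI)
  have k3 := c h12 (fun y => y.b.imJ)
  have k4 := c h12 (fun y => y.b.imK)
  have k5 := c h14 (fun y => y.b.re)
  have k6 := c h14 (fun y => y.b.imI)
  have k7 := c h14 (fun y => y.b.imJ)
  have k8 := c h14 (fun y => y.b.imK)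
  have k9 := c h24 (fun y => y.b.re)
  have k10 := c h24 (fun y => y.b.imI)
  have k11 := c h24 (fun y => y.b.imJ)
  have k12 := c h24 (fun y => y.b.imK)
  simp [e, eNat] at k1 k2 k3 k4 k5 k6 k7 k8 k9 k10 k11 k12
  apply ext_coords <;> simp <;> linarith

lemma conj_eq_neg_of_mul_self {J : Oct} (h : J * J = -1) : conj J = -J := by
  have c : ∀ (f : Oct → ℝ), f (J * J) = f (-1) := fun f => congrArg f h
  have k0 := c (fun y => y.a.re)
  have k1 := c (fun y => y.a.imI)
  have k2 := c (fun y => y.a.imJ)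
  have k3 := c (fun y => y.a.imK)
  have k4 := c (fun y => y.b.re)
  have k5 := c (fun y => y.b.imI)
  have k6 := c (fun y => y.b.imJ)
  have k7 := c (fun y => y.b.imK)
  simp at k0 k1 k2 k3 k4 k5 k6 k7
  have hre : J.a.re = 0 := by
    by_contra hne
    have hz : ∀ t : ℝ, J.a.re * t = 0 → t = 0 := fun t ht => (mul_eq_zero.mp ht).resolve_left hne
    have z1 := hz J.a.imI (by linarith)
    have z2 := hz J.a.imJ (by linarith)
    have z3 := hz J.a.imK (by linarith)
    have z4 := hz J.b.re (by linarith)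
    have z5 := hz J.b.imI (by linarith)
    have z6 := hz J.b.imJ (by linarith)
    have z7 := hz J.b.imK (by linarith)
    rw [z1, z2, z3, z4, z5, z6, z7] at k0
    nlinarith [mul_self_nonneg J.a.re]
  apply ext_coords <;> simp [hre]

end

end Oct

section ReSet

variable {V : Type*} [NormedAddCommGroup V] [NormedSpace ℝ V] [OctBimodule V]

lemma lmo_reO (p : Oct) (x : V) : lmo p (reO V x) = rmo p (reO V x) := by
  let ev : (V →L[ℝ] V) →ₗ[ℝ] V := (ContinuousLinearMap.apply ℝ V (reO V x)).toLinearMap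
  have h : ev ∘ₗ OctBimodule.lm = ev ∘ₗ OctBimodule.rm :=
    linearMap_ext ((OctBimodule.lm_one _).trans (OctBimodule.rm_one _).symm)
      fun k => DFunLike.congr_fun (lmo_mul_reO_eq V k) x
  exact LinearMap.congr_fun h p

variable (V) in
lemma assoc_mul_reO (p q : Oct) :
    ((lmo (p * q) : V →L[ℝ] V) - lmo p * lmo q) * reO V = 0 := by
  have c : ∀ p : Oct, (lmo p : V →L[ℝ] V) * reO V = rmo p * reO V := fun p =>
    ContinuousLinearMap.ext (lmo_reO p)
  have h1 := congrArg (· * reO V) (left_assoc_eq_mid_assoc V p q)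
  have h2 := congrArg (· * reO V) (left_assoc_eq_right_assoc V q p)
  have h3 := congrArg (· * reO V) (left_assoc_swap V p q)
  simp only [sub_mul, neg_mul, mul_assoc, c] at h1 h2 h3 ⊢
  linear_combination (norm := module) (1 / 3 : ℝ) • (h1 - h2 + (2 : ℝ) • h3)

lemma reO_mem_ReSet (x : V) : reO V x ∈ ReSet V :=
  ⟨fun p q => sub_eq_zero.mp (DFunLike.congr_fun (assoc_mul_reO V p q) x), fun p => lmo_reO p x⟩

lemma rmo_rmo_of_mem_ReSet {m : V} (hm : m ∈ ReSet V) (p q : Oct) :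
    rmo q (rmo p m) = rmo (p * q) m := by
  have h : lmo (p * q) m - lmo p (lmo q m) = rmo q (rmo p m) - rmo (p * q) m :=
    OctBimodule.assoc_cyc₂ p q m
  rw [hm.1, sub_self] at h
  exact sub_eq_zero.mp h.symm

lemma rmo_lmo_of_mem_ReSet {m : V} (hm : m ∈ ReSet V) (p q : Oct) :
    rmo p (lmo q m) = lmo (q * p) m := by
  rw [hm.2, hm.2, rmo_rmo_of_mem_ReSet hm]

lemma reO_lmo_of_mem_ReSet {m : V} (hm : m ∈ ReSet V) (p : Oct) :
    reO V (lmo p m) = p.a.re • m := by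
  let ev : Oct →ₗ[ℝ] V := (ContinuousLinearMap.apply ℝ V m).toLinearMap ∘ₗ OctBimodule.lm
  have h : reO V (lmo p m) = ev ((5 / 12 : ℝ) • p -
      (1 / 12 : ℝ) • ∑ i : Fin 7, (e i.succ * p) * e i.succ) := by
    rw [map_sub, map_smul, map_smul, map_sum]
    change (5 / 12 : ℝ) • lmo p m - (1 / 12 : ℝ) • (∑ i : Fin 7,
      (rmo (e i.succ)).comp (lmo (e i.succ))) (lmo p m) = _
    rw [sum_apply]
    congr 2
    refine Finset.sum_congr rfl fun i _ => ?_
    change rmo (e i.succ) (lmo (e i.succ) (lmo p m)) = lmo _ m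
    rw [← hm.1, rmo_lmo_of_mem_ReSet hm]
  rw [h, sub_sum_e_mul_mul_e, map_smul]
  exact congrArg _ (OctBimodule.lm_one m)

lemma reO_lmo_rmo_of_mem_ReSet {m : V} (hm : m ∈ ReSet V) (p q : Oct) :
    reO V (lmo p (rmo q m)) = (p * q).a.re • m := by
  rw [← hm.2, ← hm.1, reO_lmo_of_mem_ReSet hm]

lemma reO_lmo_lifO (p : Oct) (W : V →L[ℝ] V) (v : V) :
    reO V (lmo p (lifO ((reO V).comp W) v)) = reO V (W (rmo p v)) := by
  let ev : Oct →ₗ[ℝ] V := ((reO V).comp W).toLinearMap ∘ₗ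
    (ContinuousLinearMap.apply ℝ V v).toLinearMap ∘ₗ OctBimodule.rm
  have h : reO V (lmo p (lifO ((reO V).comp W) v)) =
      ev (∑ i : Fin 8, (p * e i).a.re • conj (e i)) := by
    rw [map_sum, lifO, sum_apply, map_sum, map_sum]
    refine Finset.sum_congr rfl fun i _ => ?_
    rw [map_smul]
    exact reO_lmo_rmo_of_mem_ReSet (reO_mem_ReSet _) p (e i)
  rw [h, sum_re_mul_e_smul_conj]
  rfl

/-- `π_J (W^⊚ v) = Re (W v) + Re (W (v J̄)) J` for the lift `W^⊚` of `Re ∘ W`. -/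
lemma piJ_lifO (J : Oct) (W : V →L[ℝ] V) (v : V) :
    piJ V J (lifO ((reO V).comp W) v) =
      reO V (W v) + rmo J (reO V (W (rmo (conj J) v))) := by
  have h := reO_lmo_lifO 1 W v
  rw [lmo_one, rmo_one] at h
  change reO V (lifO ((reO V).comp W) v) +
    lmo J (reO V (lmo (conj J) (lifO ((reO V).comp W) v))) = _
  rw [reO_lmo_lifO, lmo_reO]
  exact congrArg (· + _) h

/-- Continuous octonionic functionals are real-valued on the real part. -/
lemma apply_reO_eq_re_smul_one {φ : V →L[ℝ] Oct}
    (hφ : ∀ (p : Oct) (x : V), φ (rmo p x) = φ x * p) (x : V) :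
    φ (reO V x) = (φ (reO V x)).a.re • (1 : Oct) := by
  refine eq_re_smul_one_of_assoc fun p q => ?_
  rw [← hφ, ← hφ, ← hφ, rmo_rmo_of_mem_ReSet (reO_mem_ReSet x)]

end ReSet

section Resolvent

variable {V : Type*} [NormedAddCommGroup V] [NormedSpace ℝ V] [OctBimodule V]

variable (V) in
lemma rmo_smul_one_add_smul (x y : ℝ) (J : Oct) :
    (rmo (x • (1 : Oct) + y • J) : V →L[ℝ] V) = x • 1 + y • rmo J := by
  rw [← rmo_one]
  exact (map_add OctBimodule.rm _ _).trans
    (congrArg₂ _ (map_smul OctBimodule.rm x _) (map_smul OctBimodule.rm y _))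

lemma cjLiftPA_iff {J : Oct} {S : V →L[ℝ] V} :
    CJLiftPA J S ↔ ∀ (n : ℕ) (x : V), reO V ((S ^ n) (rmo J x)) = reO V (rmo J ((S ^ n) x)) := by
  refine ⟨fun h n x => ?_, fun h n _ x s hs => ?_⟩
  · rcases n.eq_zero_or_pos with rfl | hn
    · rfl
    · exact h n hn x J ⟨0, 1, by simp⟩
  · obtain ⟨a, b, rfl⟩ := hs
    simp only [rmo_smul_one_add_smul, add_apply, smul_apply, one_apply_eq_self, map_add, map_smul, h]

/-- The largest subspace of `ker Re` stable under `R_J` and the powers of `S`, for `S` that is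
`ℂ_J`-liftable power associative. -/
def liftKer (J : Oct) (S : V →L[ℝ] V) : Submodule ℝ V where
  carrier := {x | ∀ n : ℕ, reO V ((S ^ n) x) = 0 ∧ reO V ((S ^ n) (rmo J x)) = 0}
  add_mem' hx hy n := by
    simp only [map_add, (hx n).1, (hx n).2, (hy n).1, (hy n).2, add_zero, and_self]
  zero_mem' n := by simp
  smul_mem' c x hx n := by simp only [map_smul, (hx n).1, (hx n).2, smul_zero, and_self]

lemma isClosed_liftKer (J : Oct) (S : V →L[ℝ] V) : IsClosed (liftKer J S : Set V) := by
  have h : (liftKer J S : Set V) = ⋂ n : ℕ,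
      {x | reO V ((S ^ n) x) = 0} ∩ {x | reO V ((S ^ n) (rmo J x)) = 0} := by
    ext x
    simp [liftKer]
  rw [h]
  exact isClosed_iInter fun n => (isClosed_eq (by fun_prop) continuous_const).inter
    (isClosed_eq (by fun_prop) continuous_const)

/-- The operators which preserve `liftKer J S` and commute with `R_J` modulo it. -/
def liftNormalizer (J : Oct) (S : V →L[ℝ] V) : Subalgebra ℝ (V →L[ℝ] V) where
  carrier := {W | (∀ x ∈ liftKer J S, W x ∈ liftKer J S) ∧
    ∀ x, W (rmo J x) - rmo J (W x) ∈ liftKer J S}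
  mul_mem' {W₁ W₂} h₁ h₂ := by
    refine ⟨fun x hx => h₁.1 _ (h₂.1 x hx), fun x => ?_⟩
    have h := add_mem (h₁.1 _ (h₂.2 x)) (h₁.2 (W₂ x))
    rwa [map_sub, sub_add_sub_cancel] at h
  add_mem' {W₁ W₂} h₁ h₂ := by
    refine ⟨fun x hx => add_mem (h₁.1 x hx) (h₂.1 x hx), fun x => ?_⟩
    have h := add_mem (h₁.2 x) (h₂.2 x)
    rwa [sub_add_sub_comm, ← map_add] at h
  algebraMap_mem' c := by
    refine ⟨fun x hx => (liftKer J S).smul_mem c hx, fun x => ?_⟩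
    simp [Algebra.algebraMap_eq_smul_one]

lemma isClosed_liftNormalizer (J : Oct) (S : V →L[ℝ] V) :
    IsClosed (liftNormalizer J S : Set (V →L[ℝ] V)) := by
  have h : (liftNormalizer J S : Set (V →L[ℝ] V)) =
      (⋂ x ∈ liftKer J S, (fun W : V →L[ℝ] V => W x) ⁻¹' liftKer J S) ∩
      ⋂ x, (fun W : V →L[ℝ] V => W (rmo J x) - rmo J (W x)) ⁻¹' liftKer J S := by
    ext W
    simp [liftNormalizer]
  rw [h]
  exact (isClosed_biInter fun x _ => (isClosed_liftKer J S).preimage (by fun_prop)).inter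
    (isClosed_iInter fun x => (isClosed_liftKer J S).preimage (by fun_prop))

lemma cjLiftPA_of_mem_liftNormalizer {J : Oct} {S W : V →L[ℝ] V} (hW : W ∈ liftNormalizer J S) :
    CJLiftPA J W := by
  refine cjLiftPA_iff.mpr fun n x => ?_
  have h := (((pow_mem hW n).2 x) 0).1
  rw [pow_zero, one_apply_eq_self, map_sub] at h
  exact sub_eq_zero.mp h

lemma rmo_rmo_unit {J : Oct} (hJ : J ∈ unitSphere) (x : V) : rmo J (rmo J x) = -x :=
  DFunLike.congr_fun (rmo_mul_self V hJ) x

lemma rmo_mem_liftNormalizer {J : Oct} (hJ : J ∈ unitSphere) (S : V →L[ℝ] V) :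
    rmo J ∈ liftNormalizer J S := by
  refine ⟨fun x hx n => ⟨(hx n).2, ?_⟩, fun x => by simp⟩
  rw [rmo_rmo_unit hJ, map_neg, map_neg, (hx n).1, neg_zero]

lemma self_mem_liftNormalizer {J : Oct} (hJ : J ∈ unitSphere) {S : V →L[ℝ] V}
    (hS : CJLiftPA J S) : S ∈ liftNormalizer J S := by
  rw [cjLiftPA_iff] at hS
  have hpow : ∀ (n : ℕ) (x : V), (S ^ n) (S x) = (S ^ (n + 1)) x := fun n x => by
    rw [pow_succ]; rfl
  refine ⟨fun x hx n => ⟨?_, ?_⟩, fun x n => ⟨?_, ?_⟩⟩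
  · rw [hpow]
    exact (hx (n + 1)).1
  · rw [hS, hpow, ← hS]
    exact (hx (n + 1)).2
  · rw [map_sub, map_sub, hpow, hS, hS, hpow, sub_self]
  · rw [map_sub, map_sub, map_sub, rmo_rmo_unit hJ, hS, hpow, ← hS, rmo_rmo_unit hJ]
    simp

lemma inverse_one_sub_mem_liftNormalizer [CompleteSpace V] {J : Oct} {S t : V →L[ℝ] V}
    (ht : t ∈ liftNormalizer J S) (h : ‖t‖ < 1) :
    Ring.inverse (1 - t) ∈ liftNormalizer J S := by
  rw [← geom_series_eq_inverse t h]
  exact tsum_mem (isClosed_liftNormalizer J S) fun n => pow_mem ht n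

lemma isUnit_and_cjLiftPA_of_norm_lt [CompleteSpace V] {J : Oct} (hJ : J ∈ unitSphere)
    {B : V →L[ℝ] V} (hB : IsUnit B) (hS : CJLiftPA J (Ring.inverse B)) (x y : ℝ)
    (h : ‖Ring.inverse B * (x • 1 + y • rmo J)‖ < 1) :
    IsUnit (B - (x • 1 + y • rmo J)) ∧ CJLiftPA J (Ring.inverse (B - (x • 1 + y • rmo J))) := by
  set S := Ring.inverse B with hSdef
  set t := S * (x • 1 + y • rmo J) with ht
  have hmem : t ∈ liftNormalizer J S :=
    mul_mem (self_mem_liftNormalizer hJ hS) (add_mem (Subalgebra.smul_mem _ (one_mem _) x)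
      (Subalgebra.smul_mem _ (rmo_mem_liftNormalizer hJ S) y))
  have hfac : B - (x • 1 + y • rmo J) = B * (1 - t) := by
    rw [mul_sub, mul_one, ht, ← mul_assoc, Ring.mul_inverse_cancel _ hB, one_mul]
  have hu : IsUnit (1 - t) := (Units.oneSub t h).isUnit
  rw [hfac]
  refine ⟨hB.mul hu, cjLiftPA_of_mem_liftNormalizer (S := S) ?_⟩
  rw [Ring.inverse_mul (Or.inl hB)]
  exact mul_mem (inverse_one_sub_mem_liftNormalizer hmem h) (self_mem_liftNormalizer hJ hS)

/-- The map `z ↦ R_z` in the coordinates of the slice `ℂ_J`. -/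
def rmoSlice (V : Type*) [NormedAddCommGroup V] [NormedSpace ℝ V] [OctBimodule V] (J : Oct) :
    ℂ →L[ℝ] V →L[ℝ] V :=
  Complex.reCLM.smulRight (1 : V →L[ℝ] V) + Complex.imCLM.smulRight (rmo J : V →L[ℝ] V)

lemma rmoSlice_apply (J : Oct) (z : ℂ) : rmoSlice V J z = rmo (toSlice J z) :=
  (rmo_smul_one_add_smul V z.re z.im J).symm

lemma isOpen_preimage_pfResSlice [CompleteSpace V] (T : V →L[ℝ] V) {J : Oct}
    (hJ : J ∈ unitSphere) : IsOpen (toSlice J ⁻¹' pfResSlice T J) := by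
  refine isOpen_iff_mem_nhds.mpr fun z hz => ?_
  obtain ⟨-, hB, hS⟩ := hz
  set B : V →L[ℝ] V := rmo (toSlice J z) - T with hBdef
  have hcont : Continuous fun w => ‖Ring.inverse B * rmoSlice V J (z - w)‖ := by fun_prop
  have hlt : ∀ᶠ w in nhds z, ‖Ring.inverse B * rmoSlice V J (z - w)‖ < 1 :=
    hcont.continuousAt.eventually_lt continuousAt_const (by simp)
  filter_upwards [hlt] with w hw
  have hBw : rmo (toSlice J w) - T = B - rmoSlice V J (z - w) := by
    rw [hBdef, map_sub, rmoSlice_apply, rmoSlice_apply]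
    abel
  have h := isUnit_and_cjLiftPA_of_norm_lt hJ hB hS (z - w).re (z - w).im hw
  refine ⟨⟨w.re, w.im, rfl⟩, ?_⟩
  rw [hBw]
  exact h

lemma hasFDerivAt_inverse_rmoSlice_sub [CompleteSpace V] {T : V →L[ℝ] V} {J : Oct} {z : ℂ}
    (h : IsUnit (rmoSlice V J z - T)) :
    HasFDerivAt (fun w => Ring.inverse (rmoSlice V J w - T))
      (-(ContinuousLinearMap.mulLeftRight ℝ (V →L[ℝ] V) (Ring.inverse (rmoSlice V J z - T))
        (Ring.inverse (rmoSlice V J z - T))).comp (rmoSlice V J)) z := by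
  obtain ⟨u, hu⟩ := h
  have h1 : HasFDerivAt (fun w => rmoSlice V J w - T) (rmoSlice V J) z :=
    (rmoSlice V J).hasFDerivAt.sub_const T
  have h2 := hasFDerivAt_ringInverse (𝕜 := ℝ) u
  rw [← Ring.inverse_unit, hu] at h2
  exact h2.comp z h1

end Resolvent

section Holomorphy

variable {V : Type*} [NormedAddCommGroup V] [NormedSpace ℝ V] [OctBimodule V]

/-- The functional `W ↦ φ(Re (W v)) - φ(Re (W (v J)) J)`, which computes `φ(π_J(W^⊚ v))`. -/
def sliceEval (φ : V →L[ℝ] Oct) (J : Oct) (v : V) : (V →L[ℝ] V) →L[ℝ] Oct :=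
  (φ.comp (reO V)).comp (ContinuousLinearMap.apply ℝ V v) -
    (φ.comp ((rmo J).comp (reO V))).comp (ContinuousLinearMap.apply ℝ V (rmo J v))

lemma apply_piJ_lifO {φ : V →L[ℝ] Oct} {J : Oct} (hJ : J ∈ unitSphere) (W : V →L[ℝ] V) (v : V) :
    φ (piJ V J (lifO ((reO V).comp W) v)) = sliceEval φ J v W := by
  rw [piJ_lifO, conj_eq_neg_of_mul_self hJ, rmo_neg, neg_apply, map_neg, map_neg, map_neg,
    ← sub_eq_add_neg, map_sub]
  rfl

lemma sliceEval_apply {φ : V →L[ℝ] Oct} (hφ : ∀ (p : Oct) (x : V), φ (rmo p x) = φ x * p)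
    (J : Oct) (v : V) (W : V →L[ℝ] V) :
    sliceEval φ J v W =
      (φ (reO V (W v))).a.re • (1 : Oct) - (φ (reO V (W (rmo J v)))).a.re • J := by
  have h : sliceEval φ J v W = φ (reO V (W v)) - φ (reO V (W (rmo J v))) * J := by
    rw [← hφ]
    rfl
  have hs : ∀ r : ℝ, (r • (1 : Oct)) * J = r • J := fun r => by
    apply ext_coords <;> simp
  rw [h, apply_reO_eq_re_smul_one hφ (W v), apply_reO_eq_re_smul_one hφ (W (rmo J v)), hs]
  simp

lemma sliceEval_mul_rmo_mul {φ : V →L[ℝ] Oct}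
    (hφ : ∀ (p : Oct) (x : V), φ (rmo p x) = φ x * p) {J : Oct} (hJ : J ∈ unitSphere)
    {S : V →L[ℝ] V} (hS : CJLiftPA J S) (v : V) :
    sliceEval φ J v (S * rmo J * S) = J * sliceEval φ J v (S * S) := by
  have hmul : ∀ a b : ℝ, J * (a • (1 : Oct) - b • J) = b • (1 : Oct) + a • J := fun a b => by
    have h : J * (a • (1 : Oct) - b • J) = a • J - b • (J * J) := by
      apply ext_coords <;> simp <;> ring
    rw [h, show J * J = -1 from hJ, smul_neg, sub_neg_eq_add, add_comm]
  have key : ∀ x, reO V ((S * (rmo J : V →L[ℝ] V) * S) x) = reO V ((S * S) (rmo J x)) := fun x => by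
    have h1 := cjLiftPA_iff.mp hS 1 (S x)
    have h2 := cjLiftPA_iff.mp hS 2 x
    rw [pow_one] at h1
    rw [pow_two] at h2
    rw [h2]
    exact h1
  rw [sliceEval_apply hφ, sliceEval_apply hφ, hmul, key, key, rmo_rmo_unit hJ]
  simp

end Holomorphy

/-- Let `V` be a Banach `𝕆`-bimodule, `T` a bounded right para-linear
operator, `v ∈ V`, `J ∈ 𝕊`, `φ ∈ V^{*𝕆}` a continuous octonionic linear functional, and let
`g(s) = φ(π_J((R_s − T)^{−⊚}(v)))` for `s ∈ ρ_{*J}(T)`.  Then `g` takes values in `ℂ_J` and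
is holomorphic on the open subset `ρ_{*J}(T)` of `ℂ_J` (in the coordinates `z = x + y i ↦
x + y J`, it is real-differentiable with `∂g/∂y = J ∂g/∂x`). -/
theorem statement_11 {V : Type*} [NormedAddCommGroup V] [NormedSpace ℝ V] [CompleteSpace V]
    [OctBimodule V] (T : V →L[ℝ] V) (hT : IsRightPara T)
    (v : V) (J : Oct) (hJ : J ∈ unitSphere) (φ : V →L[ℝ] Oct)
    (hφ : ∀ (p : Oct) (x : V), φ (rmo p x) = φ x * p)
    (g : ℂ → Oct)
    (hg : g = fun z => φ (piJ V J (rinvL ((rmo (Oct.toSlice J z) : V →L[ℝ] V) - T) v))) :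
    IsOpen (Oct.toSlice J ⁻¹' pfResSlice T J) ∧
    ∀ z : ℂ, Oct.toSlice J z ∈ pfResSlice T J →
      g z ∈ sliceC J ∧
      DifferentiableAt ℝ g z ∧
      fderiv ℝ g z Complex.I = J * fderiv ℝ g z 1 := by
  refine ⟨isOpen_preimage_pfResSlice T hJ, fun z hz => ?_⟩
  have hgz : ∀ w, g w = sliceEval φ J v (Ring.inverse (rmoSlice V J w - T)) := fun w => by
    rw [hg, rmoSlice_apply]
    exact apply_piJ_lifO hJ _ v
  obtain ⟨-, hB, hS⟩ := hz
  rw [← rmoSlice_apply] at hB hS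
  have hd : HasFDerivAt g _ z :=
    ((sliceEval φ J v).hasFDerivAt.comp z (hasFDerivAt_inverse_rmoSlice_sub hB)).congr_of_eventuallyEq
      (.of_forall hgz)
  refine ⟨?_, hd.differentiableAt, ?_⟩
  · rw [hgz]
    rw [sliceEval_apply hφ, sub_eq_add_neg, ← neg_smul]
    exact ⟨_, _, rfl⟩
  · rw [hd.fderiv]
    set S := Ring.inverse (rmoSlice V J z - T)
    have h1 : rmoSlice V J 1 = 1 := by simp [rmoSlice]
    have hI : rmoSlice V J Complex.I = rmo J := by simp [rmoSlice]
    change sliceEval φ J v (-(S * rmoSlice V J Complex.I * S)) =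
      J * sliceEval φ J v (-(S * rmoSlice V J 1 * S))
    rw [h1, hI, mul_one, map_neg, map_neg, Oct.mul_neg, sliceEval_mul_rmo_mul hφ hJ hS]
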